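/- Let ξ ∈ L^1(Ω;ℝ^d) and α ∈ (0,1). Then D_α(ξ) ⊆ I_α(ξ) ⊆ E_α(ξ), where I_α(ξ) = (1/α)∫₀^α D_t(ξ) dt is the convex set whose support function at each u ∈ ℝ^d equals (1/α)∫₀^α h(D_t(ξ),u) dt. In particular, for every u ∈ ℝ^d, h(D_α(ξ),u) ≤ (1/α)∫₀^α h(D_t(ξ),u) dt ≤ e_α(⟨ξ,u⟩). -/

import Mathlib

open MeasureTheory RealInnerProductSpace

/-- The `t`-quantile of a distribution `ν` on `ℝ`: `q_t = inf {s : ν(-∞,s] ≥ t}`. -/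
noncomputable def quantile (ν : Measure ℝ) (t : ℝ) : ℝ :=
  sInf {s : ℝ | t ≤ (ν (Set.Iic s)).toReal}

/-- The average quantile `e_α(β) = α⁻¹ ∫_{1−α}^1 q_t(β) dt` of a distribution `ν` on `ℝ`. -/
noncomputable def avgQuantile (ν : Measure ℝ) (α : ℝ) : ℝ :=
  α⁻¹ * ∫ t in Set.Ioc (1 - α) 1, quantile ν t

/-- The (real-valued) support function `h(F,u) = sup {⟨x,u⟩ : x ∈ F}`. -/
noncomputable def suppFnR {d : ℕ} (F : Set (EuclideanSpace ℝ (Fin d)))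
    (u : EuclideanSpace ℝ (Fin d)) : ℝ :=
  sSup ((fun x => ⟪x, u⟫) '' F)

/-- The depth-trimmed region
`D_δ(ξ) = ∩_u {x : ⟨x,u⟩ ≤ q_{1−δ}(⟨ξ,u⟩)}`. -/
def depthTrimmed {Ω : Type*} [MeasureSpace Ω] {d : ℕ}
    (ξ : Ω → EuclideanSpace ℝ (Fin d)) (δ : ℝ) : Set (EuclideanSpace ℝ (Fin d)) :=
  {x | ∀ u : EuclideanSpace ℝ (Fin d),
    ⟪x, u⟫ ≤ quantile (Measure.map (fun ω => ⟪ξ ω, u⟫) volume) (1 - δ)}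

/-- The average quantile set `E_α(ξ)`: the convex closed set with support function
`u ↦ e_α(⟨ξ,u⟩)`. -/
def avgQuantileSet {Ω : Type*} [MeasureSpace Ω] {d : ℕ}
    (ξ : Ω → EuclideanSpace ℝ (Fin d)) (α : ℝ) : Set (EuclideanSpace ℝ (Fin d)) :=
  {x | ∀ u : EuclideanSpace ℝ (Fin d),
    ⟪x, u⟫ ≤ avgQuantile (Measure.map (fun ω => ⟪ξ ω, u⟫) volume) α}

open Classical in
/-- The Aumann integral `I_α(ξ) = α⁻¹ ∫₀^α D_t(ξ) dt`: the convex set whose support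
function at `u` is `α⁻¹ ∫₀^α h(D_t(ξ),u) dt`; it is empty whenever some `D_t(ξ)`,
`t ∈ (0,α)`, is empty. -/
noncomputable def intDepthTrimmed {Ω : Type*} [MeasureSpace Ω] {d : ℕ}
    (ξ : Ω → EuclideanSpace ℝ (Fin d)) (α : ℝ) : Set (EuclideanSpace ℝ (Fin d)) :=
  if ∀ t ∈ Set.Ioo (0:ℝ) α, (depthTrimmed ξ t).Nonempty then
    {x | ∀ u : EuclideanSpace ℝ (Fin d),
      ⟪x, u⟫ ≤ α⁻¹ * ∫ t in Set.Ioo (0:ℝ) α, suppFnR (depthTrimmed ξ t) u}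
  else ∅

/-- The distribution function of `ν` and the quantile form a Galois connection on `(0,1)`. -/
theorem quantile_le_iff (ν : Measure ℝ) [IsProbabilityMeasure ν] {t : ℝ}
    (ht : t ∈ Set.Ioo (0:ℝ) 1) (s : ℝ) :
    quantile ν t ≤ s ↔ t ≤ (ν (Set.Iic s)).toReal := by
  have hF : ∀ x, (ν (Set.Iic x)).toReal = ProbabilityTheory.cdf ν x := fun x =>
    (ProbabilityTheory.cdf_eq_real ν x).symm
  simp only [quantile, hF]
  obtain ⟨a, ha⟩ := ((ProbabilityTheory.tendsto_cdf_atBot ν).eventually_lt_const ht.1).exists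
  obtain ⟨b, hb⟩ := ((ProbabilityTheory.tendsto_cdf_atTop ν).eventually_const_lt ht.2).exists
  have hbdd : BddBelow {s | t ≤ ProbabilityTheory.cdf ν s} := by
    refine ⟨a, fun x hx => ?_⟩
    by_contra! h
    exact absurd (hx.trans (ProbabilityTheory.monotone_cdf ν h.le)) ha.not_ge
  refine ⟨fun h => ?_, fun h => csInf_le hbdd h⟩
  have hright := ((ProbabilityTheory.cdf ν).right_continuous s).mono Set.Ioi_subset_Ici_self
  refine ge_of_tendsto hright ?_
  filter_upwards [self_mem_nhdsWithin] with y hy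
  obtain ⟨z, hz, hzy⟩ := exists_lt_of_csInf_lt ⟨b, hb.le⟩ (h.trans_lt hy)
  exact hz.trans (ProbabilityTheory.monotone_cdf ν hzy.le)

theorem monotoneOn_quantile (ν : Measure ℝ) [IsProbabilityMeasure ν] :
    MonotoneOn (quantile ν) (Set.Ioo 0 1) := fun _ hs _ ht hst =>
  (quantile_le_iff ν hs _).2 (hst.trans ((quantile_le_iff ν ht _).1 le_rfl))

theorem aemeasurable_quantile (ν : Measure ℝ) [IsProbabilityMeasure ν] :
    AEMeasurable (quantile ν) (volume.restrict (Set.Ioo (0:ℝ) 1)) :=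
  aemeasurable_restrict_of_monotoneOn measurableSet_Ioo (monotoneOn_quantile ν)

/-- Inverse transform sampling: the quantile function pushes the uniform law to `ν`. -/
theorem map_quantile (ν : Measure ℝ) [IsProbabilityMeasure ν] :
    Measure.map (quantile ν) (volume.restrict (Set.Ioo (0:ℝ) 1)) = ν := by
  refine (Measure.ext_of_Iic _ _ fun s => ?_).symm
  rw [Measure.map_apply_of_aemeasurable (aemeasurable_quantile ν) measurableSet_Iic,
    Measure.restrict_apply' measurableSet_Ioo]
  have h : quantile ν ⁻¹' Set.Iic s ∩ Set.Ioo 0 1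
      = Set.Iic (ν (Set.Iic s)).toReal ∩ Set.Ioo 0 1 := by
    ext t
    simp only [Set.mem_inter_iff, Set.mem_preimage, Set.mem_Iic, and_congr_left_iff]
    exact fun ht => quantile_le_iff ν ht s
  have h1 : (ν (Set.Iic s)).toReal ≤ 1 := ENNReal.toReal_le_of_le_ofReal zero_le_one
    (by simpa using prob_le_one)
  have h2 : (Set.Iic (ν (Set.Iic s)).toReal ∩ Set.Ioo 0 1 : Set ℝ)
      =ᵐ[volume] Set.Ioc 0 (ν (Set.Iic s)).toReal := by
    have : (Set.Ioc 0 (ν (Set.Iic s)).toReal : Set ℝ)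
        = Set.Iic (ν (Set.Iic s)).toReal ∩ Set.Ioc 0 1 := by
      ext t
      simp only [Set.mem_Ioc, Set.mem_inter_iff, Set.mem_Iic]
      exact ⟨fun h => ⟨h.2, h.1, h.2.trans h1⟩, fun h => ⟨h.2.1, h.1⟩⟩
    rw [this]
    exact (Filter.EventuallyEq.refl _ _).inter Ioo_ae_eq_Ioc
  rw [h, measure_congr h2, Real.volume_Ioc, sub_zero, ENNReal.ofReal_toReal (by finiteness)]

theorem integrableOn_quantile (ν : Measure ℝ) [IsProbabilityMeasure ν] (hν : Integrable id ν) :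
    IntegrableOn (quantile ν) (Set.Ioo 0 1) := by
  rw [← map_quantile ν] at hν
  exact (integrable_map_measure aestronglyMeasurable_id (aemeasurable_quantile ν)).1 hν

theorem integrableOn_quantile_one_sub (ν : Measure ℝ) [IsProbabilityMeasure ν]
    (hν : Integrable id ν) {α : ℝ} (hα : α ∈ Set.Ioo (0:ℝ) 1) :
    IntegrableOn (fun t => quantile ν (1 - t)) (Set.Ioo 0 α) := by
  have h : IntervalIntegrable (quantile ν) volume 1 0 :=
    ((intervalIntegrable_iff_integrableOn_Ioo_of_le zero_le_one).2
      (integrableOn_quantile ν hν)).symm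
  have h' := h.comp_sub_left 1
  rw [sub_self, sub_zero, intervalIntegrable_iff_integrableOn_Ioo_of_le zero_le_one] at h'
  exact h'.mono_set (Set.Ioo_subset_Ioo_right hα.2.le)

theorem avgQuantile_eq (ν : Measure ℝ) {α : ℝ} (hα : 0 ≤ α) :
    avgQuantile ν α = α⁻¹ * ∫ t in Set.Ioo (0:ℝ) α, quantile ν (1 - t) := by
  rw [avgQuantile, ← integral_Ioc_eq_integral_Ioo, ← intervalIntegral.integral_of_le hα,
    ← intervalIntegral.integral_of_le (by linarith),
    intervalIntegral.integral_comp_sub_left (quantile ν) 1, sub_zero]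

theorem bddAbove_inner_depthTrimmed {Ω : Type*} [MeasureSpace Ω] {d : ℕ}
    (ξ : Ω → EuclideanSpace ℝ (Fin d)) (t : ℝ) (u : EuclideanSpace ℝ (Fin d)) :
    BddAbove ((fun x => ⟪x, u⟫) '' depthTrimmed ξ t) := by
  refine ⟨quantile (Measure.map (fun ω => ⟪ξ ω, u⟫) volume) (1 - t), ?_⟩
  rintro _ ⟨x, hx, rfl⟩
  exact hx u

theorem suppFnR_depthTrimmed_le {Ω : Type*} [MeasureSpace Ω] {d : ℕ}
    {ξ : Ω → EuclideanSpace ℝ (Fin d)} {t : ℝ} (h : (depthTrimmed ξ t).Nonempty)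
    (u : EuclideanSpace ℝ (Fin d)) :
    suppFnR (depthTrimmed ξ t) u
      ≤ quantile (Measure.map (fun ω => ⟪ξ ω, u⟫) volume) (1 - t) := by
  refine csSup_le (h.image _) ?_
  rintro _ ⟨x, hx, rfl⟩
  exact hx u

theorem inner_le_suppFnR_depthTrimmed {Ω : Type*} [MeasureSpace Ω] {d : ℕ}
    {ξ : Ω → EuclideanSpace ℝ (Fin d)} {t : ℝ} {x : EuclideanSpace ℝ (Fin d)}
    (hx : x ∈ depthTrimmed ξ t) (u : EuclideanSpace ℝ (Fin d)) :
    ⟪x, u⟫ ≤ suppFnR (depthTrimmed ξ t) u :=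
  le_csSup (bddAbove_inner_depthTrimmed ξ t u) ⟨x, hx, rfl⟩

section Random

variable {Ω : Type*} [MeasureSpace Ω] [IsProbabilityMeasure (volume : Measure Ω)] {d : ℕ}
  {ξ : Ω → EuclideanSpace ℝ (Fin d)}

theorem isProbabilityMeasure_map_inner (hξ : AEMeasurable ξ) (u : EuclideanSpace ℝ (Fin d)) :
    IsProbabilityMeasure (Measure.map (fun ω => ⟪ξ ω, u⟫) volume) :=
  Measure.isProbabilityMeasure_map (hξ.inner_const)

theorem depthTrimmed_antitoneOn (hξ : AEMeasurable ξ) :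
    AntitoneOn (depthTrimmed ξ) (Set.Ioo 0 1) := by
  intro s hs t ht hst x hx u
  have := isProbabilityMeasure_map_inner hξ u
  exact (hx u).trans (monotoneOn_quantile _ ⟨by linarith [ht.2], by linarith [ht.1]⟩
    ⟨by linarith [hs.2], by linarith [hs.1]⟩ (by linarith))

theorem integrableOn_quantile_inner (hξ : Integrable ξ) {α : ℝ} (hα : α ∈ Set.Ioo (0:ℝ) 1)
    (u : EuclideanSpace ℝ (Fin d)) :
    IntegrableOn (fun t => quantile (Measure.map (fun ω => ⟪ξ ω, u⟫) volume) (1 - t))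
      (Set.Ioo 0 α) := by
  have := isProbabilityMeasure_map_inner hξ.aemeasurable u
  refine integrableOn_quantile_one_sub _ ?_ hα
  exact (integrable_map_measure aestronglyMeasurable_id (hξ.aemeasurable.inner_const)).2
    (hξ.inner_const u)

theorem integrableOn_suppFnR_depthTrimmed (hξ : Integrable ξ) {α : ℝ}
    (hα : α ∈ Set.Ioo (0:ℝ) 1) (hne : ∀ t ∈ Set.Ioo (0:ℝ) α, (depthTrimmed ξ t).Nonempty)
    (u : EuclideanSpace ℝ (Fin d)) :
    IntegrableOn (fun t => suppFnR (depthTrimmed ξ t) u) (Set.Ioo 0 α) := by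
  have hanti : AntitoneOn (fun t => suppFnR (depthTrimmed ξ t) u) (Set.Ioo 0 α) :=
    fun s hs t ht hst => csSup_le_csSup (bddAbove_inner_depthTrimmed ξ s u) ((hne t ht).image _)
      (Set.image_mono (depthTrimmed_antitoneOn hξ.aemeasurable
        ⟨hs.1, hs.2.trans hα.2⟩ ⟨ht.1, ht.2.trans hα.2⟩ hst))
  have hmeas := aemeasurable_restrict_of_antitoneOn (μ := volume) measurableSet_Ioo hanti
  refine integrable_of_le_of_le hmeas.aestronglyMeasurable ?_ ?_
    (integrableOn_quantile_inner hξ hα (-u)).neg (integrableOn_quantile_inner hξ hα u)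
  · filter_upwards [ae_restrict_mem measurableSet_Ioo] with t ht
    obtain ⟨x, hx⟩ := hne t ht
    have h1 := hx (-u)
    have h2 := inner_le_suppFnR_depthTrimmed hx u
    rw [inner_neg_right] at h1
    simp only [Pi.neg_apply]
    linarith
  · filter_upwards [ae_restrict_mem measurableSet_Ioo] with t ht
    exact suppFnR_depthTrimmed_le (hne t ht) u

theorem integral_suppFnR_depthTrimmed_le (hξ : Integrable ξ) {α : ℝ}
    (hα : α ∈ Set.Ioo (0:ℝ) 1) (hne : ∀ t ∈ Set.Ioo (0:ℝ) α, (depthTrimmed ξ t).Nonempty)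
    (u : EuclideanSpace ℝ (Fin d)) :
    α⁻¹ * (∫ t in Set.Ioo (0:ℝ) α, suppFnR (depthTrimmed ξ t) u) ≤
      avgQuantile (Measure.map (fun ω => ⟪ξ ω, u⟫) volume) α := by
  rw [avgQuantile_eq _ hα.1.le]
  refine mul_le_mul_of_nonneg_left ?_ (inv_nonneg.2 hα.1.le)
  exact setIntegral_mono_on (integrableOn_suppFnR_depthTrimmed hξ hα hne u)
    (integrableOn_quantile_inner hξ hα u) measurableSet_Ioo
    fun t ht => suppFnR_depthTrimmed_le (hne t ht) u

theorem inner_le_integral_suppFnR_depthTrimmed (hξ : Integrable ξ) {α : ℝ}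
    (hα : α ∈ Set.Ioo (0:ℝ) 1) {x : EuclideanSpace ℝ (Fin d)} (hx : x ∈ depthTrimmed ξ α)
    (u : EuclideanSpace ℝ (Fin d)) :
    ⟪x, u⟫ ≤ α⁻¹ * ∫ t in Set.Ioo (0:ℝ) α, suppFnR (depthTrimmed ξ t) u := by
  have hmem : ∀ t ∈ Set.Ioo (0:ℝ) α, x ∈ depthTrimmed ξ t := fun t ht =>
    depthTrimmed_antitoneOn hξ.aemeasurable ⟨ht.1, ht.2.trans hα.2⟩ hα ht.2.le hx
  have h := setIntegral_mono_on (μ := volume) (f := fun _ => ⟪x, u⟫)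
    (integrableOn_const (by simp))
    (integrableOn_suppFnR_depthTrimmed hξ hα (fun t ht => ⟨x, hmem t ht⟩) u) measurableSet_Ioo
    fun t ht => inner_le_suppFnR_depthTrimmed (hmem t ht) u
  rw [setIntegral_const, Real.volume_real_Ioo_of_le hα.1.le, sub_zero, smul_eq_mul] at h
  rwa [le_inv_mul_iff₀ hα.1]

end Random

/-- for `ξ ∈ L¹(Ω;ℝ^d)` and `α ∈ (0,1)`, one has
`D_α(ξ) ⊆ (1/α)∫₀^α D_t(ξ) dt ⊆ E_α(ξ)`; in particular, for every `u`,
`h(D_α(ξ),u) ≤ (1/α)∫₀^α h(D_t(ξ),u) dt ≤ e_α(⟨ξ,u⟩)`. -/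
theorem statement9
    {Ω : Type*} [MeasureSpace Ω] [IsProbabilityMeasure (volume : Measure Ω)]
    {d : ℕ}
    (ξ : Ω → EuclideanSpace ℝ (Fin d)) (hξmeas : Measurable ξ) (hξint : Integrable ξ)
    (α : ℝ) (hα : α ∈ Set.Ioo (0:ℝ) 1) :
    depthTrimmed ξ α ⊆ intDepthTrimmed ξ α ∧
    intDepthTrimmed ξ α ⊆ avgQuantileSet ξ α ∧
    ((depthTrimmed ξ α).Nonempty → ∀ u : EuclideanSpace ℝ (Fin d),
      suppFnR (depthTrimmed ξ α) u ≤
        α⁻¹ * ∫ t in Set.Ioo (0:ℝ) α, suppFnR (depthTrimmed ξ t) u ∧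
      α⁻¹ * (∫ t in Set.Ioo (0:ℝ) α, suppFnR (depthTrimmed ξ t) u) ≤
        avgQuantile (Measure.map (fun ω => ⟪ξ ω, u⟫) volume) α) := by
  have hne : (depthTrimmed ξ α).Nonempty → ∀ t ∈ Set.Ioo (0:ℝ) α, (depthTrimmed ξ t).Nonempty :=
    fun h t ht => h.mono (depthTrimmed_antitoneOn hξmeas.aemeasurable
      ⟨ht.1, ht.2.trans hα.2⟩ hα ht.2.le)
  refine ⟨fun x hx => ?_, fun x hx => ?_, fun h u => ⟨?_, ?_⟩⟩
  · rw [intDepthTrimmed, if_pos (hne ⟨x, hx⟩)]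
    exact inner_le_integral_suppFnR_depthTrimmed hξint hα hx
  · rw [intDepthTrimmed] at hx
    split_ifs at hx with h
    · exact fun u => (hx u).trans (integral_suppFnR_depthTrimmed_le hξint hα h u)
    · exact hx.elim
  · refine csSup_le (h.image _) ?_
    rintro _ ⟨x, hx, rfl⟩
    exact inner_le_integral_suppFnR_depthTrimmed hξint hα hx u
  · exact integral_suppFnR_depthTrimmed_le hξint hα (hne h) u
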